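/- arXiv:gr-qc/0606016 — 4 statements merged into one kernel-verified Lean document; each statement's English description precedes it below -/
import Mathlib

section
/- Let t_i < t_s be real numbers and let a : [t_i, t_s] → ℝ be continuously differentiable with a(t) > 0 for all t ∈ [t_i, t_s]. Define H = a′/a and λ(t) = ∫_{t_i}^t a(u)/a(t_s) du. If the averaged Hubble rate H_av := (λ(t_s) − λ(t_i))^{-1} · ∫_{t_i}^{t_s} H(t)·(a(t)/a(t_s)) dt is strictly positive, then λ(t_s) − λ(t_i) ≤ 1/H_av. -/
open Set MeasureTheory Filter Topology

/-- With `a` continuously differentiable and positive on `[t_i, t_s]`,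
`H = a'/a`, `λ(t) = ∫_{t_i}^t a(u)/a(t_s) du`, and averaged Hubble rate
`H_av = (λ(t_s) - λ(t_i))⁻¹ · ∫_{t_i}^{t_s} H·(a/a(t_s))`, if `H_av > 0` then
`λ(t_s) - λ(t_i) ≤ 1/H_av`. -/
theorem stmt_3 (ti ts : ℝ) (hlt : ti < ts) (a a' : ℝ → ℝ)
    (ha_deriv : ∀ t ∈ Set.Icc ti ts, HasDerivAt a (a' t) t)
    (ha'_cont : ContinuousOn a' (Set.Icc ti ts))
    (ha_pos : ∀ t ∈ Set.Icc ti ts, 0 < a t)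
    (lam : ℝ → ℝ) (hlam : ∀ t, lam t = ∫ u in ti..t, a u / a ts)
    (Hav : ℝ)
    (hHav : Hav = (lam ts - lam ti)⁻¹ * ∫ t in ti..ts, (a' t / a t) * (a t / a ts))
    (hHav_pos : 0 < Hav) :
    lam ts - lam ti ≤ 1 / Hav := by
  have hI : (∫ t in ti..ts, (a' t / a t) * (a t / a ts)) = (a ts - a ti) / a ts := by
    have h1 : (∫ t in ti..ts, (a' t / a t) * (a t / a ts)) = ∫ t in ti..ts, a' t / a ts := by
      apply intervalIntegral.integral_congr
      intro t ht
      rw [Set.uIcc_of_le hlt.le] at ht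
      have := (ha_pos t ht).ne'
      have := (ha_pos ts ⟨hlt.le, le_rfl⟩).ne'
      simp only
      field_simp
    rw [h1, intervalIntegral.integral_div]
    congr 1
    apply intervalIntegral.integral_eq_sub_of_hasDerivAt
    · intro t ht
      rw [Set.uIcc_of_le hlt.le] at ht
      exact ha_deriv t ht
    · apply ContinuousOn.intervalIntegrable
      rwa [Set.uIcc_of_le hlt.le]
  have hts := ha_pos ts ⟨hlt.le, le_rfl⟩
  have hti := ha_pos ti ⟨le_rfl, hlt.le⟩
  have hL : lam ts - lam ti ≠ 0 := by
    intro h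
    rw [h, inv_zero, zero_mul] at hHav
    exact hHav_pos.ne' hHav
  rw [le_div_iff₀ hHav_pos, hHav, mul_inv_cancel_left₀ hL, hI, div_le_one hts]
  linarith
end

section
/- Let C₁, C₂, C₃ > 0 and define a(τ) = (C₁·e^{−C₃τ} + C₂·e^{C₃τ})^{2/3} for τ ≥ 0. Then a(τ) ≥ (2√(C₁C₂))^{2/3} > 0 for all τ ≥ 0, and the Bel–Robinson energy density |E|² + |D|² := 3(a″/a)² + 3((a′/a)²)² tends to the finite limit 6·(2C₃/3)⁴ as τ → ∞. -/
open Set Filter Topology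

/-- For the Chaplygin-gas scale factor
`a(τ) = (C₁ e^{-C₃τ} + C₂ e^{C₃τ})^{2/3}`, one has
`a(τ) ≥ (2√(C₁C₂))^{2/3} > 0` for all `τ ≥ 0`, and the Bel–Robinson energy density
`|E|² + |D|² = 3(a''/a)² + 3((a'/a)²)²` tends to `6·(2C₃/3)⁴` as `τ → ∞`. -/
theorem stmt_5 (C₁ C₂ C₃ : ℝ) (h₁ : 0 < C₁) (h₂ : 0 < C₂) (h₃ : 0 < C₃)
    (a : ℝ → ℝ)
    (ha : ∀ τ, a τ = (C₁ * Real.exp (-C₃ * τ) + C₂ * Real.exp (C₃ * τ)) ^ (2 / 3 : ℝ)) :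
    (∀ τ, 0 ≤ τ → (2 * Real.sqrt (C₁ * C₂)) ^ (2 / 3 : ℝ) ≤ a τ) ∧
    0 < (2 * Real.sqrt (C₁ * C₂)) ^ (2 / 3 : ℝ) ∧
    Filter.Tendsto
      (fun τ => 3 * (deriv (deriv a) τ / a τ) ^ 2 + 3 * ((deriv a τ / a τ) ^ 2) ^ 2)
      Filter.atTop (nhds (6 * (2 * C₃ / 3) ^ 4)) := by
  have hu : ∀ τ, 0 < C₁ * Real.exp (-C₃ * τ) + C₂ * Real.exp (C₃ * τ) := fun τ => by positivity
  have hE : ∀ τ, HasDerivAt (fun τ => Real.exp (C₃ * τ)) (C₃ * Real.exp (C₃ * τ)) τ := fun τ => by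
    have := ((hasDerivAt_id τ).const_mul C₃).exp
    refine HasDerivAt.congr_deriv this ?_
    simp only [id]; ring
  have hE2 : ∀ τ, HasDerivAt (fun τ => Real.exp (-C₃ * τ)) (-C₃ * Real.exp (-C₃ * τ)) τ := fun τ => by
    have := ((hasDerivAt_id τ).const_mul (-C₃)).exp
    refine HasDerivAt.congr_deriv this ?_
    simp only [id]; ring
  set u : ℝ → ℝ := fun τ => C₁ * Real.exp (-C₃ * τ) + C₂ * Real.exp (C₃ * τ) with hud
  set v : ℝ → ℝ := fun τ => -(C₁ * Real.exp (-C₃ * τ)) + C₂ * Real.exp (C₃ * τ) with hvd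
  have hu : ∀ τ, 0 < u τ := hu
  have hu' : ∀ τ, HasDerivAt u (C₃ * v τ) τ := fun τ => by
    have := ((hE2 τ).const_mul C₁).add ((hE τ).const_mul C₂)
    refine this.congr_deriv ?_
    simp only [hvd]; ring
  have hv' : ∀ τ, HasDerivAt v (C₃ * u τ) τ := fun τ => by
    have := ((hE2 τ).const_mul C₁).neg.add ((hE τ).const_mul C₂)
    refine this.congr_deriv ?_
    simp only [hud]; ring
  have haf : a = fun τ => u τ ^ (2 / 3 : ℝ) := funext ha
  have hapos : ∀ τ, 0 < a τ := fun τ => by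
    rw [haf]; exact Real.rpow_pos_of_pos (hu τ) _
  have ha' : ∀ τ, HasDerivAt a (a τ * (2 / 3 * C₃ * (v τ / u τ))) τ := fun τ => by
    have := (hu' τ).rpow_const (p := (2 / 3 : ℝ)) (Or.inl (hu τ).ne')
    rw [Real.rpow_sub_one (hu τ).ne'] at this
    rw [haf]
    refine this.congr_deriv ?_
    ring
  have hda : deriv a = fun τ => a τ * (2 / 3 * C₃ * (v τ / u τ)) := funext fun τ => (ha' τ).deriv
  have hdda : ∀ τ, deriv (deriv a) τ
      = a τ * (2 / 3 * C₃ ^ 2 * (1 - (v τ / u τ) ^ 2) + 4 / 9 * C₃ ^ 2 * (v τ / u τ) ^ 2) := fun τ => by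
    rw [hda]
    have := (ha' τ).mul (((hv' τ).div (hu' τ) (hu τ).ne').const_mul (2 / 3 * C₃))
    refine (HasDerivAt.deriv this).trans ?_
    have := (hu τ).ne'
    simp only [Pi.div_apply]
    field_simp
    ring
  have hr : Tendsto (fun τ => v τ / u τ) atTop (𝓝 1) := by
    have h0 : Tendsto (fun τ => Real.exp (-(2 * C₃ * τ))) atTop (𝓝 0) :=
      Real.tendsto_exp_neg_atTop_nhds_zero.comp
        (tendsto_id.const_mul_atTop (by positivity : 0 < 2 * C₃))
    have h1 : Tendsto (fun τ => (-(C₁ * Real.exp (-(2 * C₃ * τ))) + C₂) /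
        (C₁ * Real.exp (-(2 * C₃ * τ)) + C₂)) atTop (𝓝 ((-(C₁ * 0) + C₂) / (C₁ * 0 + C₂))) :=
      ((h0.const_mul C₁).neg.add_const C₂).div ((h0.const_mul C₁).add_const C₂)
        (by simpa using h₂.ne')
    have h2 : (-(C₁ * 0) + C₂) / (C₁ * 0 + C₂) = 1 := by
      simp [h₂.ne']
    rw [h2] at h1
    refine h1.congr fun τ => ?_
    have e : Real.exp (-C₃ * τ) = Real.exp (-(2 * C₃ * τ)) * Real.exp (C₃ * τ) := by
      rw [← Real.exp_add]; congr 1; ring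
    simp only [hud, hvd, e]
    rw [← mul_div_mul_right _ _ (Real.exp_pos (C₃ * τ)).ne']
    congr 1 <;> ring
  refine ⟨fun τ _ => ?_, by positivity, ?_⟩
  · rw [haf]
    refine Real.rpow_le_rpow (by positivity) ?_ (by norm_num)
    have e : Real.exp (-C₃ * τ) * Real.exp (C₃ * τ) = 1 := by
      rw [← Real.exp_add]; simp
    have h4 : Real.sqrt (C₁ * C₂) ≤ u τ / 2 := by
      refine Real.sqrt_le_iff.2 ⟨(half_pos (hu τ)).le, ?_⟩
      have h5 : C₁ * C₂ = (C₁ * Real.exp (-C₃ * τ)) * (C₂ * Real.exp (C₃ * τ)) := by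
        linear_combination (-C₁ * C₂) * e
      rw [h5]
      simp only [hud]
      nlinarith [sq_nonneg (C₁ * Real.exp (-C₃ * τ) - C₂ * Real.exp (C₃ * τ))]
    linarith
  · have key : Tendsto (fun τ => 3 * (2 / 3 * C₃ ^ 2 * (1 - (v τ / u τ) ^ 2)
        + 4 / 9 * C₃ ^ 2 * (v τ / u τ) ^ 2) ^ 2 + 3 * ((2 / 3 * C₃ * (v τ / u τ)) ^ 2) ^ 2) atTop
        (𝓝 (3 * (2 / 3 * C₃ ^ 2 * (1 - (1:ℝ) ^ 2)
        + 4 / 9 * C₃ ^ 2 * (1:ℝ) ^ 2) ^ 2 + 3 * ((2 / 3 * C₃ * (1:ℝ)) ^ 2) ^ 2)) := by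
      have hc : Continuous (fun r : ℝ => 3 * (2 / 3 * C₃ ^ 2 * (1 - r ^ 2)
        + 4 / 9 * C₃ ^ 2 * r ^ 2) ^ 2 + 3 * ((2 / 3 * C₃ * r) ^ 2) ^ 2) := by fun_prop
      exact (hc.tendsto 1).comp hr
    have e : 6 * (2 * C₃ / 3) ^ 4 = 3 * (2 / 3 * C₃ ^ 2 * (1 - (1:ℝ) ^ 2)
        + 4 / 9 * C₃ ^ 2 * (1:ℝ) ^ 2) ^ 2 + 3 * ((2 / 3 * C₃ * (1:ℝ)) ^ 2) ^ 2 := by ring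
    rw [e]
    refine key.congr fun τ => ?_
    rw [hdda, hda]
    simp only [mul_div_cancel_left₀ _ (hapos τ).ne']
end

section
/- Given constants t_s > 0, a_s > 1, 0 < q < 1, 1 < n < 2, and B < 0 with |B|·t_s^n < 1, define a(t) = 1 + (t/t_s)^q·(a_s − 1) + B·(t_s − t)^n for t ∈ (0, t_s]. Then a(t) > 0 for all t ∈ (0, t_s], a(t_s) = a_s, the derivative a′(t) tends to the finite limit q(a_s − 1)/t_s as t → t_s⁻ (so the Hubble rate H = a′/a has the finite limit q(a_s − 1)/(t_s·a_s) there), and a″(t) → −∞ as t → t_s⁻. -/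
open Set Filter Topology

/-- For Barrow's sudden-singularity scale factor
`a(t) = 1 + (t/t_s)^q (a_s - 1) + B (t_s - t)^n` on `(0, t_s]` (with `t_s > 0`,
`a_s > 1`, `0 < q < 1`, `1 < n < 2`, `B < 0`, `|B| t_s^n < 1`): `a > 0` on `(0,t_s]`,
`a(t_s) = a_s`, `a'(t) → q(a_s-1)/t_s` as `t → t_s⁻` (so `H = a'/a` tends to the finite
limit `q(a_s-1)/(t_s a_s)` there), and `a''(t) → -∞` as `t → t_s⁻`. -/
theorem stmt_9 (ts as q n B : ℝ) (hts : 0 < ts) (has : 1 < as)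
    (hq0 : 0 < q) (hq1 : q < 1) (hn1 : 1 < n) (hn2 : n < 2)
    (hB : B < 0) (hBts : |B| * ts ^ n < 1)
    (a : ℝ → ℝ)
    (ha : ∀ t, a t = 1 + (t / ts) ^ q * (as - 1) + B * (ts - t) ^ n) :
    (∀ t ∈ Set.Ioc 0 ts, 0 < a t) ∧
    a ts = as ∧
    Filter.Tendsto (deriv a) (nhdsWithin ts (Set.Iio ts)) (nhds (q * (as - 1) / ts)) ∧
    Filter.Tendsto (fun t => deriv a t / a t) (nhdsWithin ts (Set.Iio ts))
      (nhds (q * (as - 1) / (ts * as))) ∧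
    Filter.Tendsto (deriv (deriv a)) (nhdsWithin ts (Set.Iio ts)) Filter.atBot := by
  have hd1 : ∀ t ∈ Set.Ioo 0 ts, HasDerivAt a
      (q * (as - 1) / ts * (t / ts) ^ (q - 1) + -(B * n) * (ts - t) ^ (n - 1)) t := by
    intro t ht
    have e : a = fun t => 1 + (t / ts) ^ q * (as - 1) + B * (ts - t) ^ n := funext ha
    rw [e]
    have h1 : HasDerivAt (fun t : ℝ => t / ts) (1 / ts) t := (hasDerivAt_id t).div_const ts
    have h2 : HasDerivAt (fun t : ℝ => ts - t) (-1) t := (hasDerivAt_id t).const_sub ts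
    have h3 := h1.rpow_const (p := q) (Or.inl (div_pos ht.1 hts).ne')
    have h4 := h2.rpow_const (p := n) (Or.inl (sub_pos.2 ht.2).ne')
    refine HasDerivAt.congr_deriv (((h3.mul_const (as - 1)).const_add 1).fun_add (h4.const_mul B)) ?_
    ring
  have hd2 : ∀ t ∈ Set.Ioo 0 ts, HasDerivAt (deriv a)
      (q * (as - 1) / ts * ((q - 1) / ts) * (t / ts) ^ (q - 2)
        + (B * n * (n - 1)) * (ts - t) ^ (n - 2)) t := by
    intro t ht
    have e : deriv a =ᶠ[𝓝 t] fun t =>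
        q * (as - 1) / ts * (t / ts) ^ (q - 1) + -(B * n) * (ts - t) ^ (n - 1) := by
      filter_upwards [Ioo_mem_nhds ht.1 ht.2] with x hx
      exact (hd1 x hx).deriv
    refine HasDerivAt.congr_of_eventuallyEq ?_ e
    have h1 : HasDerivAt (fun t : ℝ => t / ts) (1 / ts) t := (hasDerivAt_id t).div_const ts
    have h2 : HasDerivAt (fun t : ℝ => ts - t) (-1) t := (hasDerivAt_id t).const_sub ts
    have h3 := h1.rpow_const (p := q - 1) (Or.inl (div_pos ht.1 hts).ne')
    have h4 := h2.rpow_const (p := n - 1) (Or.inl (sub_pos.2 ht.2).ne')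
    convert (h3.const_mul (q * (as - 1) / ts)).fun_add (h4.const_mul (-(B * n))) using 1
    rw [show q - 1 - 1 = q - 2 by ring, show n - 1 - 1 = n - 2 by ring]
    ring
  have hev : ∀ᶠ t in 𝓝[<] ts, t ∈ Set.Ioo 0 ts := Ioo_mem_nhdsLT hts
  have hats : a ts = as := by
    rw [ha, div_self hts.ne', sub_self, Real.one_rpow, Real.zero_rpow (by linarith)]
    ring
  have l1 : Tendsto (fun t : ℝ => t / ts) (𝓝[<] ts) (𝓝 1) := by
    have : Tendsto (fun t : ℝ => t / ts) (𝓝 ts) (𝓝 (ts / ts)) :=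
      (continuous_id.div_const ts).tendsto ts
    rw [div_self hts.ne'] at this
    exact this.mono_left nhdsWithin_le_nhds
  have lp : ∀ p : ℝ, Tendsto (fun t : ℝ => (t / ts) ^ p) (𝓝[<] ts) (𝓝 1) := by
    intro p
    have := l1.rpow_const (p := p) (Or.inl one_ne_zero)
    rwa [Real.one_rpow] at this
  have l0 : Tendsto (fun t : ℝ => ts - t) (𝓝[<] ts) (𝓝 0) := by
    have : Tendsto (fun t : ℝ => ts - t) (𝓝 ts) (𝓝 (ts - ts)) :=
      (continuous_const.sub continuous_id).tendsto ts
    rw [sub_self] at this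
    exact this.mono_left nhdsWithin_le_nhds
  have lz : ∀ p : ℝ, 0 < p → Tendsto (fun t : ℝ => (ts - t) ^ p) (𝓝[<] ts) (𝓝 0) := by
    intro p hp
    have := l0.rpow_const (p := p) (Or.inr hp.le)
    rwa [Real.zero_rpow hp.ne'] at this
  have l0' : Tendsto (fun t : ℝ => ts - t) (𝓝[<] ts) (𝓝[>] 0) := by
    refine tendsto_nhdsWithin_iff.2 ⟨l0, ?_⟩
    filter_upwards [hev] with t ht
    exact sub_pos.2 ht.2
  have la' : Tendsto (deriv a) (𝓝[<] ts) (𝓝 (q * (as - 1) / ts)) := by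
    have := ((lp (q - 1)).const_mul (q * (as - 1) / ts)).add
      ((lz (n - 1) (by linarith)).const_mul (-(B * n)))
    rw [mul_one, mul_zero, add_zero] at this
    refine this.congr' ?_
    filter_upwards [hev] with t ht
    exact (hd1 t ht).deriv.symm
  have la : Tendsto a (𝓝[<] ts) (𝓝 as) := by
    have := (((lp q).mul_const (as - 1)).const_add 1).add
      ((lz n (by linarith)).const_mul B)
    rw [show 1 + 1 * (as - 1) + B * 0 = as by ring] at this
    exact this.congr fun t => (ha t).symm
  refine ⟨?_, hats, la', ?_, ?_⟩
  · intro t ht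
    rw [ha]
    have h1 : 0 < (t / ts) ^ q := Real.rpow_pos_of_pos (div_pos ht.1 hts) q
    have h2 : (ts - t) ^ n ≤ ts ^ n :=
      Real.rpow_le_rpow (sub_nonneg.2 ht.2) (by linarith [ht.1]) (by linarith)
    rw [abs_of_neg hB] at hBts
    have h3 := mul_pos h1 (sub_pos.2 has)
    nlinarith
  · have := la'.div la (by linarith)
    rwa [div_div] at this
  · have h1 : Tendsto (fun t : ℝ => (ts - t) ^ (n - 2)) (𝓝[<] ts) atTop :=
      (tendsto_rpow_neg_nhdsGT_zero (by linarith)).comp l0'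
    have hc : B * n * (n - 1) < 0 :=
      mul_neg_of_neg_of_pos (mul_neg_of_neg_of_pos hB (by linarith)) (by linarith)
    have := ((lp (q - 2)).const_mul (q * (as - 1) / ts * ((q - 1) / ts))).add_atBot
      (h1.const_mul_atTop_of_neg hc)
    refine this.congr' ?_
    filter_upwards [hev] with t ht
    exact (hd2 t ht).deriv.symm
end

section
/- Given constants t_s > 0, a_s > 1, 0 < q < 1, 1 < n < 2, and B < 0 with |B|·t_s^n < 1, define a(t) = 1 + (t/t_s)^q·(a_s − 1) + B·(t_s − t)^n for t ∈ (0, t_s]. Then 2a″(t)/a(t) + (a′(t)/a(t))² → −∞ as t → t_s⁻, and consequently the quantity 9(a′/a)⁴ + 3(2a″/a + (a′/a)²)² tends to +∞ as t → t_s⁻. -/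
open Set Filter Topology

/-- For Barrow's sudden-singularity scale factor
`a(t) = 1 + (t/t_s)^q (a_s - 1) + B (t_s - t)^n`: `2a''/a + (a'/a)² → -∞` as
`t → t_s⁻` (divergence of the pressure `p = -(2a''/a + (a'/a)²)`), and consequently
`9(a'/a)⁴ + 3(2a''/a + (a'/a)²)² → +∞` as `t → t_s⁻` (divergence of `E_{αβ}E^{αβ}`). -/
theorem stmt_11 (ts as q n B : ℝ) (hts : 0 < ts) (has : 1 < as)
    (hq0 : 0 < q) (hq1 : q < 1) (hn1 : 1 < n) (hn2 : n < 2)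
    (hB : B < 0) (hBts : |B| * ts ^ n < 1)
    (a : ℝ → ℝ)
    (ha : ∀ t, a t = 1 + (t / ts) ^ q * (as - 1) + B * (ts - t) ^ n) :
    Filter.Tendsto (fun t => 2 * deriv (deriv a) t / a t + (deriv a t / a t) ^ 2)
      (nhdsWithin ts (Set.Iio ts)) Filter.atBot ∧
    Filter.Tendsto
      (fun t => 9 * (deriv a t / a t) ^ 4 +
        3 * (2 * deriv (deriv a) t / a t + (deriv a t / a t) ^ 2) ^ 2)
      (nhdsWithin ts (Set.Iio ts)) Filter.atTop := by
  have e : a = fun t => 1 + (t / ts) ^ q * (as - 1) + B * (ts - t) ^ n := funext ha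
  have hev : ∀ᶠ t in 𝓝[<] ts, t ∈ Ioo 0 ts := Ioo_mem_nhdsLT hts
  have hpow1 : ∀ (p t : ℝ), t ∈ Ioo 0 ts →
      HasDerivAt (fun t => (t / ts) ^ p) (1 / ts * p * (t / ts) ^ (p - 1)) t := by
    intro p t ht
    have h := (hasDerivAt_id t).div_const ts
    exact h.rpow_const (Or.inl (div_pos ht.1 hts).ne')
  have hpow2 : ∀ (p t : ℝ), t ∈ Ioo 0 ts →
      HasDerivAt (fun t => (ts - t) ^ p) (-1 * p * (ts - t) ^ (p - 1)) t := by
    intro p t ht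
    have h := (hasDerivAt_id t).const_sub ts
    exact h.rpow_const (Or.inl (sub_pos.2 ht.2).ne')
  have hd1 : ∀ t ∈ Ioo 0 ts, deriv a t =
      1 / ts * q * (t / ts) ^ (q - 1) * (as - 1) + B * (-1 * n * (ts - t) ^ (n - 1)) := by
    intro t ht
    rw [e]
    exact ((((hpow1 q t ht).mul_const (as - 1)).const_add 1).add
      ((hpow2 n t ht).const_mul B)).deriv
  have hd2 : ∀ t ∈ Ioo 0 ts, deriv (deriv a) t =
      1 / ts * q * (1 / ts * (q - 1) * (t / ts) ^ (q - 1 - 1)) * (as - 1)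
        + B * (-1 * n * (-1 * (n - 1) * (ts - t) ^ (n - 1 - 1))) := by
    intro t ht
    have h : deriv a =ᶠ[𝓝 t] fun t =>
      1 / ts * q * (t / ts) ^ (q - 1) * (as - 1) + B * (-1 * n * (ts - t) ^ (n - 1)) := by
      filter_upwards [Ioo_mem_nhds ht.1 ht.2] with x hx using hd1 x hx
    rw [h.deriv_eq]
    exact ((((hpow1 (q - 1) t ht).const_mul (1 / ts * q)).mul_const (as - 1)).add
      (((hpow2 (n - 1) t ht).const_mul (-1 * n)).const_mul B)).deriv
  have l1 : ∀ p : ℝ, Tendsto (fun t => (t / ts) ^ p) (𝓝[<] ts) (𝓝 1) := by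
    intro p
    have h : ContinuousAt (fun t => (t / ts) ^ p) ts :=
      (continuousAt_id.div_const ts).rpow_const (Or.inl (by simp [hts.ne']))
    have h2 := h.tendsto.mono_left (nhdsWithin_le_nhds (s := Iio ts))
    simpa [div_self hts.ne'] using h2
  have l2 : ∀ p : ℝ, 0 < p → Tendsto (fun t => (ts - t) ^ p) (𝓝[<] ts) (𝓝 0) := by
    intro p hp
    have h : ContinuousAt (fun t => (ts - t) ^ p) ts :=
      (continuousAt_const.sub continuousAt_id).rpow_const (Or.inr hp.le)
    have h2 := h.tendsto.mono_left (nhdsWithin_le_nhds (s := Iio ts))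
    simpa [Real.zero_rpow hp.ne'] using h2
  have l3 : Tendsto (fun t => (ts - t) ^ (n - 1 - 1)) (𝓝[<] ts) atTop := by
    have h : Tendsto (fun t => (ts - t) ^ (2 - n)) (𝓝[<] ts) (𝓝[>] 0) := by
      refine tendsto_nhdsWithin_iff.2 ⟨l2 _ (by linarith), ?_⟩
      filter_upwards [hev] with t ht using Real.rpow_pos_of_pos (sub_pos.2 ht.2) _
    refine (tendsto_inv_nhdsGT_zero.comp h).congr' ?_
    filter_upwards [hev] with t ht
    have : n - 1 - 1 = -(2 - n) := by ring
    rw [this, Real.rpow_neg (sub_pos.2 ht.2).le]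
    rfl
  have la : Tendsto a (𝓝[<] ts) (𝓝 as) := by
    have h := (((l1 q).mul_const (as - 1)).const_add 1).add ((l2 n (by linarith)).const_mul B)
    rw [e]
    convert h using 2
    ring
  have has0 : 0 < as := by linarith
  obtain ⟨c, lb⟩ : ∃ c, Tendsto (deriv a) (𝓝[<] ts) (𝓝 c) := by
    refine ⟨_, Tendsto.congr' ?_ ((((l1 (q - 1)).const_mul (1 / ts * q)).mul_const (as - 1)).add
      (((l2 (n - 1) (by linarith)).const_mul (-1 * n)).const_mul B))⟩
    filter_upwards [hev] with t ht using (hd1 t ht).symm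
  have lc : Tendsto (deriv (deriv a)) (𝓝[<] ts) atBot := by
    have hk : B * n * (n - 1) < 0 :=
      mul_neg_of_neg_of_pos (mul_neg_of_neg_of_pos hB (by linarith)) (by linarith)
    refine Tendsto.congr' ?_ (((((l1 (q - 1 - 1)).const_mul (1 / ts * (q - 1))).const_mul
      (1 / ts * q)).mul_const (as - 1)).add_atBot (l3.const_mul_atTop_of_neg hk))
    filter_upwards [hev] with t ht
    rw [hd2 t ht]
    ring
  have main : Tendsto (fun t => 2 * deriv (deriv a) t / a t + (deriv a t / a t) ^ 2)
      (𝓝[<] ts) atBot := by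
    refine Tendsto.atBot_add ?_ ((lb.div la has0.ne').pow 2)
    simp only [div_eq_mul_inv]
    exact (lc.const_mul_atBot two_pos).atBot_mul_pos (inv_pos.2 has0) (la.inv₀ has0.ne')
  refine ⟨main, ?_⟩
  refine tendsto_atTop_mono' _ ?_ (tendsto_neg_atBot_atTop.comp main)
  filter_upwards [main.eventually_le_atBot (-1)] with t hX
  simp only [Function.comp]
  revert hX
  generalize 2 * deriv (deriv a) t / a t + (deriv a t / a t) ^ 2 = X
  intro hX
  have : 0 ≤ (deriv a t / a t) ^ 4 := by positivity
  nlinarith [sq_nonneg (X + 1), sq_nonneg X]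
end
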